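/- arXiv:2409.19547 — 4 statements merged into one kernel-verified Lean document; each statement's English description precedes it below -/
import Mathlib

section
/- For every integer n ≥ 2, the number of desarrangements of length n avoiding the pattern 321 equals the Catalan number C_{n-1}, i.e. d_n({321}) = C_{n-1}. -/
open scoped Classical

/-- Index `i ∈ {1,…,n}` (1-indexed) is an ascent of the permutation `π` of length `n`,
written in one-line notation `π₁π₂⋯πₙ` with `πᵢ = π ⟨i-1, _⟩`: either `i = n`, or
`πᵢ < πᵢ₊₁`. -/
def IsAscent (n : ℕ) (π : Equiv.Perm (Fin n)) (i : ℕ) : Prop :=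
  1 ≤ i ∧ i ≤ n ∧ (i = n ∨ ∃ h : i < n, π ⟨i - 1, by omega⟩ < π ⟨i, h⟩)

/-- A permutation is a desarrangement if it is empty or its first (smallest) ascent is even. -/
def IsDesarrangement (n : ℕ) (π : Equiv.Perm (Fin n)) : Prop :=
  n = 0 ∨ ∃ i, IsAscent n π i ∧ Even i ∧ ∀ j, IsAscent n π j → i ≤ j

/-- `π` contains the pattern `σ` (where `σ` is given in 0-indexed one-line notation):
there are positions `i₁ < ⋯ < i_k` such that the letters of `π` at these positions are
in the same relative order as the letters of `σ`. -/
def ContainsPattern {k n : ℕ} (σ : Fin k → Fin k) (π : Equiv.Perm (Fin n)) : Prop :=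
  ∃ f : Fin k ↪o Fin n, ∀ a b : Fin k, π (f a) < π (f b) ↔ σ a < σ b

/-- `d_n(P)`: the number of desarrangements of length `n` avoiding every pattern in `P`
(patterns of length 3, in 0-indexed one-line notation). -/
noncomputable def dcount (n : ℕ) (P : Finset (Fin 3 → Fin 3)) : ℕ :=
  (Finset.univ.filter fun π : Equiv.Perm (Fin n) =>
    IsDesarrangement n π ∧ ∀ σ ∈ P, ¬ ContainsPattern σ π).card

namespace Desarrangement

/-- The permutation whose one-line notation starts with `p`, followed by a word that is
order-isomorphic to `σ`. -/
noncomputable def insertFront {n : ℕ} (p : Fin (n + 1)) (σ : Equiv.Perm (Fin n)) :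
    Equiv.Perm (Fin (n + 1)) :=
  Equiv.ofBijective (Fin.cons p fun i => p.succAbove (σ i)) <|
    Finite.injective_iff_bijective.1 <| Fin.cons_injective_iff.2
      ⟨by rintro ⟨i, hi⟩; exact Fin.succAbove_ne _ _ hi,
        Fin.succAbove_right_injective.comp σ.injective⟩

@[simp] theorem insertFront_zero {n : ℕ} (p : Fin (n + 1)) (σ : Equiv.Perm (Fin n)) :
    insertFront p σ 0 = p := rfl

@[simp] theorem insertFront_succ {n : ℕ} (p : Fin (n + 1)) (σ : Equiv.Perm (Fin n)) (i : Fin n) :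
    insertFront p σ i.succ = p.succAbove (σ i) := rfl

theorem insertFront_bijective (n : ℕ) :
    Function.Bijective fun x : Fin (n + 1) × Equiv.Perm (Fin n) => insertFront x.1 x.2 := by
  refine (Fintype.bijective_iff_injective_and_card _).2 ⟨?_, ?_⟩
  · rintro ⟨p, σ⟩ ⟨q, τ⟩ h
    have hp : p = q := by simpa using DFunLike.congr_fun h 0
    subst hp
    refine Prod.ext rfl (Equiv.ext fun i => ?_)
    simpa using DFunLike.congr_fun h i.succ
  · simp [Fintype.card_perm, Nat.factorial_succ]

theorem card_filter_perm_succ {n : ℕ} (P : Equiv.Perm (Fin (n + 1)) → Prop)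
    [DecidablePred P] :
    (Finset.univ.filter P).card =
      ∑ p : Fin (n + 1),
        (Finset.univ.filter fun σ : Equiv.Perm (Fin n) => P (insertFront p σ)).card := by
  simp only [Finset.card_filter]
  rw [← (insertFront_bijective n).sum_comp fun π => if P π then 1 else 0, Fintype.sum_prod_type]

/-- `π` has no decreasing subsequence of length three. -/
def Avoids321 {n : ℕ} (π : Equiv.Perm (Fin n)) : Prop :=
  ∀ i j k, i < j → j < k → π j < π i → π j < π k

/-- The values of `π` smaller than `a` appear in increasing order. -/
def IncreasingBelow {n : ℕ} (a : ℕ) (π : Equiv.Perm (Fin n)) : Prop :=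
  ∀ i j, i < j → (π i : ℕ) < a → π i < π j

theorem containsPattern_iff {n : ℕ} (π : Equiv.Perm (Fin n)) :
    ContainsPattern ![2, 1, 0] π ↔ ¬ Avoids321 π := by
  constructor
  · rintro ⟨f, hf⟩ h
    have h10 : π (f 1) < π (f 0) := (hf 1 0).2 (by decide)
    have h21 : π (f 2) < π (f 1) := (hf 2 1).2 (by decide)
    exact absurd (h _ _ _ (f.strictMono (by decide)) (f.strictMono (by decide)) h10) h21.not_gt
  · intro h
    simp only [Avoids321, not_forall, not_lt] at h
    obtain ⟨i, j, k, hij, hjk, hji, hkj⟩ := h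
    have hkj' : π k < π j := lt_of_le_of_ne hkj (by simpa using hjk.ne')
    refine ⟨OrderEmbedding.ofStrictMono ![i, j, k] ?_, ?_⟩
    · rw [Fin.strictMono_iff_lt_succ]
      intro a
      fin_cases a <;> simpa
    · intro a b
      fin_cases a <;> fin_cases b <;>
        simp [hji, hkj', hji.le, hkj'.le, hkj'.trans hji, (hkj'.trans hji).le]

theorem isDesarrangement_iff {n : ℕ} {π : Equiv.Perm (Fin (n + 2))} (h : Avoids321 π) :
    IsDesarrangement (n + 2) π ↔ π 1 < π 0 := by
  constructor
  · rintro (h0 | ⟨i, ⟨hi, -, -⟩, heven, hmin⟩)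
    · omega
    · by_contra hlt
      have h01 : π 0 < π 1 := lt_of_le_of_ne (not_lt.1 hlt) (by simp)
      have := hmin 1 ⟨le_rfl, by omega, Or.inr ⟨by omega, h01⟩⟩
      obtain rfl : i = 1 := by omega
      exact absurd heven (by decide)
  · intro h10
    refine Or.inr ⟨2, ⟨by omega, by omega, ?_⟩, even_two, ?_⟩
    · rcases Nat.eq_zero_or_pos n with rfl | hn
      · exact Or.inl rfl
      · exact Or.inr ⟨by omega, h 0 1 ⟨2, by omega⟩ (by simp) (by simp [Fin.lt_def]) h10⟩
    · rintro j ⟨hj, -, hasc⟩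
      by_contra hj2
      obtain rfl : j = 1 := by omega
      rcases hasc with h1 | ⟨_, h01⟩
      · omega
      · exact h10.not_gt h01

theorem avoids321_insertFront {n : ℕ} (p : Fin (n + 1)) (σ : Equiv.Perm (Fin n)) :
    Avoids321 (insertFront p σ) ↔ Avoids321 σ ∧ IncreasingBelow p σ := by
  constructor
  · intro h
    refine ⟨fun i j k hij hjk hji => ?_, fun i j hij hi => ?_⟩
    · simpa [hji] using h i.succ j.succ k.succ (by simpa) (by simpa)
    · have := h 0 i.succ j.succ (by simp) (by simpa)
      simp only [insertFront_zero, insertFront_succ, Fin.succAbove_lt_iff_castSucc_lt] at this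
      simpa using this hi
  · rintro ⟨hσ, hp⟩ i j k hij hjk hji
    obtain ⟨j, rfl⟩ := Fin.exists_succ_eq.2 (Fin.ne_zero_of_lt hij)
    obtain ⟨k, rfl⟩ := Fin.exists_succ_eq.2 (Fin.ne_zero_of_lt hjk)
    simp only [Fin.succ_lt_succ_iff] at hjk
    simp only [insertFront_succ, Fin.succAbove_lt_succAbove_iff] at hji ⊢
    cases i using Fin.cases with
    | zero => exact hp j k hjk ((Fin.succAbove_lt_iff_castSucc_lt _ _).1 hji)
    | succ i => exact hσ i j k (by simpa using hij) hjk (by simpa using hji)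

theorem increasingBelow_insertFront_zero {n : ℕ} (a : ℕ) (σ : Equiv.Perm (Fin n)) :
    IncreasingBelow (a + 1) (insertFront 0 σ) ↔ IncreasingBelow a σ := by
  constructor
  · intro h i j hij hi
    simpa using h i.succ j.succ (by simpa) (by simpa)
  · intro h i j hij hi
    obtain ⟨j, rfl⟩ := Fin.exists_succ_eq.2 (Fin.ne_zero_of_lt hij)
    cases i using Fin.cases with
    | zero => simp
    | succ i => simpa using h i j (by simpa using hij) (by simpa using hi)

theorem increasingBelow_insertFront_succ {n : ℕ} (a : ℕ) (p : Fin n) (σ : Equiv.Perm (Fin n))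
    (h : IncreasingBelow (p.succ : Fin (n + 1)) σ) :
    IncreasingBelow (a + 1) (insertFront p.succ σ) ↔ a ≤ p := by
  constructor
  · intro hinc
    by_contra hlt
    have : NeZero n := ⟨(p.pos).ne'⟩
    have := hinc 0 (σ.symm 0).succ (by simp) (by simp; omega)
    simp [Fin.lt_def, Fin.succAbove] at this
  · intro hap i j hij hi
    obtain ⟨j, rfl⟩ := Fin.exists_succ_eq.2 (Fin.ne_zero_of_lt hij)
    cases i using Fin.cases with
    | zero => simp at hi; omega
    | succ i =>
      have hlt : p.succ.succAbove (σ i) < p.succ := by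
        rw [Fin.lt_def]
        simp only [insertFront_succ, Fin.val_succ] at hi ⊢
        omega
      rw [Fin.succAbove_lt_iff_castSucc_lt] at hlt
      simpa using h i j (by simpa using hij) hlt

/-- The number of 321-avoiding permutations of length `n` in which the values smaller than `a`
appear in increasing order. -/
noncomputable def avoiderCount (n a : ℕ) : ℕ :=
  (Finset.univ.filter fun π : Equiv.Perm (Fin n) => Avoids321 π ∧ IncreasingBelow a π).card

theorem increasingBelow_zero {n : ℕ} (π : Equiv.Perm (Fin n)) : IncreasingBelow 0 π :=
  fun _ _ _ h => absurd h (Nat.not_lt_zero _)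

theorem increasingBelow_one {n : ℕ} (π : Equiv.Perm (Fin n)) : IncreasingBelow 1 π := by
  intro i j hij hi
  have hne : π i ≠ π j := by simpa using hij.ne
  rw [Fin.lt_def]
  have := Fin.val_ne_of_ne hne
  omega

theorem avoiderCount_one (n : ℕ) : avoiderCount n 1 = avoiderCount n 0 := by
  simp [avoiderCount, increasingBelow_zero, increasingBelow_one]

theorem avoiderCount_succ_succ (n a : ℕ) :
    avoiderCount (n + 1) (a + 1) =
      avoiderCount n a + ∑ p : Fin n, if a ≤ p then avoiderCount n (p + 1) else 0 := by
  rw [avoiderCount, card_filter_perm_succ, Fin.sum_univ_succ]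
  congr 1
  · simp [avoiderCount, avoids321_insertFront, increasingBelow_insertFront_zero,
      increasingBelow_zero]
  · refine Finset.sum_congr rfl fun p _ => ?_
    have key : ∀ σ : Equiv.Perm (Fin n),
        (Avoids321 (insertFront p.succ σ) ∧ IncreasingBelow (a + 1) (insertFront p.succ σ)) ↔
          (Avoids321 σ ∧ IncreasingBelow (p + 1) σ) ∧ a ≤ p := by
      intro σ
      rw [avoids321_insertFront]
      exact and_congr_right fun h => increasingBelow_insertFront_succ a p σ h.2
    simp only [key, avoiderCount]
    split_ifs with hap <;> simp [hap]

theorem avoiderCount_succ_succ_of_lt {n a : ℕ} (h : a < n) :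
    avoiderCount (n + 1) (a + 1) = avoiderCount n a + avoiderCount (n + 1) (a + 2) := by
  rw [avoiderCount_succ_succ, avoiderCount_succ_succ n (a + 1)]
  congr 1
  rw [← Finset.add_sum_erase _ _ (Finset.mem_univ (⟨a, h⟩ : Fin n)),
    ← Finset.add_sum_erase _ (fun p : Fin n => if a + 1 ≤ p then _ else _)
      (Finset.mem_univ (⟨a, h⟩ : Fin n))]
  simp only [le_refl, if_true, Nat.not_succ_le_self, if_false, zero_add]
  congr 1
  refine Finset.sum_congr rfl fun p hp => ?_
  have hne : (p : ℕ) ≠ a := fun hpa => (Finset.mem_erase.1 hp).1 (Fin.ext hpa)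
  have : a ≤ p ↔ a + 1 ≤ p := by omega
  simp only [this]

theorem avoiderCount_succ_self (n : ℕ) :
    avoiderCount (n + 1) (n + 1) = avoiderCount n n := by
  rw [avoiderCount_succ_succ, Finset.sum_eq_zero, add_zero]
  intro p _
  rw [if_neg (by omega)]

theorem avoiderCount_add_choose (n d : ℕ) (hd : d ≤ n) :
    avoiderCount n (n - d) + (n + d).choose (n + 1) = (n + d).choose n := by
  induction n generalizing d with
  | zero =>
    obtain rfl : d = 0 := by omega
    simp [avoiderCount, increasingBelow_zero, Avoids321]
  | succ n ih =>
    induction d with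
    | zero =>
      have := ih 0 (Nat.zero_le _)
      simpa [avoiderCount_succ_self] using this
    | succ d ihd =>
      have h₁ := ihd (by omega)
      have pascal₁ := Nat.choose_succ_succ (n + 1 + d) n
      have pascal₂ := Nat.choose_succ_succ (n + 1 + d) (n + 1)
      simp only [Nat.succ_eq_add_one] at pascal₁ pascal₂
      rw [← add_assoc, pascal₁, pascal₂]
      rcases (Nat.le_of_succ_le_succ hd).lt_or_eq with hlt | rfl
      · have h₂ := ih (d + 1) hlt
        obtain ⟨a, rfl⟩ := Nat.exists_eq_add_of_lt hlt
        rw [show d + a + 1 + 1 - (d + 1) = a + 1 by omega,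
          avoiderCount_succ_succ_of_lt (by omega)]
        rw [show d + a + 1 - (d + 1) = a by omega,
          show d + a + 1 + (d + 1) = d + a + 1 + 1 + d by omega] at h₂
        rw [show d + a + 1 + 1 - d = a + 2 by omega] at h₁
        omega
      · have hsymm := Nat.choose_symm_half d
        rw [show d + 1 - d = 1 by omega, avoiderCount_one] at h₁
        rw [Nat.sub_self]
        rw [show 2 * d + 1 = d + 1 + d by omega] at hsymm
        omega

theorem avoiderCount_zero_eq_catalan (n : ℕ) : avoiderCount n 0 = catalan n := by
  have h := avoiderCount_add_choose n n le_rfl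
  rw [Nat.sub_self, ← two_mul] at h
  have hc := Nat.choose_succ_right_eq (2 * n) n
  rw [show 2 * n - n = n by omega] at hc
  have hcat := succ_mul_catalan_eq_centralBinom n
  rw [Nat.centralBinom] at hcat
  refine Nat.eq_of_mul_eq_mul_left n.succ_pos ?_
  rw [Nat.succ_eq_add_one, hcat]
  nlinarith

theorem dcount_eq (n : ℕ) : dcount (n + 2) {![2, 1, 0]} = avoiderCount (n + 1) 1 := by
  have hfilter : dcount (n + 2) {![2, 1, 0]} = (Finset.univ.filter
      fun π : Equiv.Perm (Fin (n + 2)) => Avoids321 π ∧ π 1 < π 0).card := by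
    refine congrArg Finset.card (Finset.filter_congr fun π _ => ?_)
    simp only [Finset.mem_singleton, forall_eq, containsPattern_iff, not_not]
    rw [and_comm]
    exact and_congr_right isDesarrangement_iff
  have hone (p : Fin (n + 2)) (q : Fin (n + 1)) (σ : Equiv.Perm (Fin n)) :
      insertFront p (insertFront q σ) 1 < insertFront p (insertFront q σ) 0 ↔
        q.castSucc < p := by
    rw [← Fin.succ_zero_eq_one, insertFront_succ, insertFront_zero, insertFront_zero,
      Fin.succAbove_lt_iff_castSucc_lt]
  rw [hfilter, card_filter_perm_succ, Fin.sum_univ_succ]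
  have hzero : (Finset.univ.filter fun τ : Equiv.Perm (Fin (n + 1)) =>
      Avoids321 (insertFront 0 τ) ∧ insertFront 0 τ 1 < insertFront 0 τ 0).card = 0 := by
    simp
  have hsucc (p : Fin (n + 1)) : (Finset.univ.filter fun τ : Equiv.Perm (Fin (n + 1)) =>
      Avoids321 (insertFront p.succ τ) ∧ insertFront p.succ τ 1 < insertFront p.succ τ 0).card =
        avoiderCount n p := by
    rw [card_filter_perm_succ, Fin.sum_univ_succ, Finset.sum_eq_zero, add_zero, avoiderCount]
    · refine congrArg Finset.card (Finset.filter_congr fun σ _ => ?_)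
      rw [hone, avoids321_insertFront, avoids321_insertFront, Fin.val_succ,
        increasingBelow_insertFront_zero]
      simp [increasingBelow_zero]
    · intro q _
      rw [Finset.card_eq_zero, Finset.filter_eq_empty_iff]
      rintro σ - ⟨h, hlt⟩
      rw [hone] at hlt
      rw [avoids321_insertFront, avoids321_insertFront, Fin.val_succ] at h
      have := (increasingBelow_insertFront_succ p q σ h.1.2).1 h.2
      simp [Fin.lt_def] at hlt
      omega
  rw [hzero, zero_add, Finset.sum_congr rfl fun p _ => hsucc p, avoiderCount_succ_succ,
    Fin.sum_univ_succ]
  simp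

end Desarrangement

/-- For every integer `n ≥ 2`, the number of desarrangements of length `n` avoiding the
pattern 321 equals the Catalan number `C_(n-1)`. -/
theorem desarrangements_avoiding_321 (n : ℕ) (hn : 2 ≤ n) :
    dcount n {![2,1,0]} = catalan (n - 1) := by
  obtain ⟨m, rfl⟩ := Nat.exists_eq_add_of_le' hn
  rw [Desarrangement.dcount_eq, Desarrangement.avoiderCount_one,
    Desarrangement.avoiderCount_zero_eq_catalan]
  rfl
end

section
/- For every integer n ≥ 2 and each pattern σ ∈ {132, 231}, the number of desarrangements of length n avoiding σ equals the Fine number F_{n+1}, i.e. d_n({σ}) = F_{n+1}. -/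
open scoped Classical

/-- The list `l` avoids the pattern `132` (for `b = true`) or `231` (for `b = false`): no entry
between two others in position exceeds both of them while the outer two are increasing
(resp. decreasing). -/
def PeakAvoiding (b : Bool) (l : List ℕ) : Prop :=
  l.Triplewise fun x y z => ¬((if b then x < z else z < x) ∧ x < y ∧ z < y)

theorem peakAvoiding_append_cons {b : Bool} {l r : List ℕ} {m : ℕ}
    (hl : ∀ x ∈ l, x < m) (hr : ∀ x ∈ r, x < m) :
    PeakAvoiding b (l ++ m :: r) ↔ PeakAvoiding b l ∧ PeakAvoiding b r ∧
      ∀ x ∈ l, ∀ z ∈ r, ¬(if b then x < z else z < x) := by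
  unfold PeakAvoiding
  simp only [List.triplewise_append, List.triplewise_cons, List.pairwise_cons]
  constructor
  · rintro ⟨h1, ⟨-, h2⟩, h3, -⟩
    refine ⟨h1, h2, fun x hx z hz h => (h3 x hx).1 z hz ⟨h, hl x hx, hr z hz⟩⟩
  · rintro ⟨h1, h2, h3⟩
    refine ⟨h1, ⟨?_, h2⟩, fun x hx => ⟨fun z hz h => h3 x hx z hz h.1, ?_⟩, fun z hz => ?_⟩
    · refine List.pairwise_of_forall_mem_list fun x hx y _ h => ?_
      have := hr x hx
      omega
    · exact List.pairwise_of_forall_mem_list fun y _ z hz h => h3 x hx z hz h.1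
    · refine List.pairwise_of_forall_mem_list fun x hx y hy h => ?_
      rcases List.mem_cons.1 hz with rfl | hz
      · have := hl y hy
        omega
      · exact h3 x hx z hz h.1

/-- The pattern-avoiding arrangement of `k, …, k + t.numNodes - 1` whose tree of successive maxima
is `t`. -/
def treeWord (b : Bool) : ℕ → BinaryTree Unit → List ℕ
  | _, .nil => []
  | k, .node _ l r =>
    treeWord b (k + if b then r.numNodes else 0) l ++ (k + (l.numNodes + r.numNodes)) ::
      treeWord b (k + if b then 0 else l.numNodes) r

theorem treeWord_perm (b : Bool) (t : BinaryTree Unit) (k : ℕ) :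
    (treeWord b k t).Perm (List.range' k t.numNodes) := by
  induction t generalizing k with
  | nil => simp [treeWord]
  | node _ l r hl hr =>
    rw [treeWord, BinaryTree.numNodes, List.range'_1_concat]
    refine List.perm_middle.trans (.trans (.cons _ ?_) (List.perm_append_singleton _ _).symm)
    refine ((hl _).append (hr _)).trans ?_
    cases b
    · simp
    · rw [Nat.add_comm l.numNodes, ← List.range'_append_1]
      exact List.perm_append_comm

theorem length_treeWord (b : Bool) (t : BinaryTree Unit) (k : ℕ) :
    (treeWord b k t).length = t.numNodes := by
  simpa using (treeWord_perm b t k).length_eq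

theorem mem_treeWord {b : Bool} {t : BinaryTree Unit} {k x : ℕ} :
    x ∈ treeWord b k t ↔ k ≤ x ∧ x < k + t.numNodes := by
  rw [(treeWord_perm b t k).mem_iff, List.mem_range'_1]

theorem peakAvoiding_treeWord (b : Bool) (t : BinaryTree Unit) (k : ℕ) :
    PeakAvoiding b (treeWord b k t) := by
  induction t generalizing k with
  | nil => exact .nil
  | node _ l r hl hr =>
    rw [treeWord, peakAvoiding_append_cons]
    · refine ⟨hl _, hr _, fun x hx z hz => ?_⟩
      rw [mem_treeWord] at hx hz
      cases b <;> simp at hx hz ⊢ <;> omega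
    all_goals
      intro x hx
      rw [mem_treeWord] at hx
      cases b <;> simp at hx <;> omega

theorem treeWord_injective (b : Bool) (k : ℕ) : Function.Injective (treeWord b k) := by
  intro t
  induction t generalizing k with
  | nil =>
    intro t' h
    cases t' with
    | nil => rfl
    | node => simp [treeWord] at h
  | node _ l r hl hr =>
    intro t' h
    cases t' with
    | nil => simp [treeWord] at h
    | node _ l' r' =>
      have hn := congrArg List.length h
      simp only [length_treeWord, BinaryTree.numNodes] at hn
      rw [treeWord, treeWord, List.append_cons_inj_of_notMem] at h
      · obtain ⟨h1, -, h2⟩ := h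
        have n1 := congrArg List.length h1
        have n2 := congrArg List.length h2
        simp only [length_treeWord] at n1 n2
        rw [n2] at h1
        rw [n1] at h2
        rw [hl _ h1, hr _ h2]
      all_goals
        rw [mem_treeWord]
        cases b <;> simp <;> omega

/-- If every entry of `s` is smaller than every entry of `l`, and together they form an interval,
then each of them forms an interval. -/
theorem perm_range'_of_append {s l : List ℕ} {k n : ℕ} (h : (s ++ l).Perm (List.range' k n))
    (hlt : ∀ x ∈ s, ∀ y ∈ l, x ≤ y) :
    s.Perm (List.range' k s.length) ∧ l.Perm (List.range' (k + s.length) l.length) := by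
  have hs := s.mergeSort_perm (· ≤ ·)
  have hl := l.mergeSort_perm (· ≤ ·)
  have hn : n = s.length + l.length := by simpa using h.length_eq.symm
  have key : s.mergeSort (· ≤ ·) ++ l.mergeSort (· ≤ ·) =
      List.range' k s.length ++ List.range' (k + s.length) l.length := by
    rw [List.range'_append_1, ← hn]
    refine List.Perm.eq_of_pairwise (le := (· ≤ ·)) (fun _ _ _ _ => le_antisymm) ?_ ?_
      ((hs.append hl).trans h)
    · refine List.pairwise_append.2 ⟨?_, ?_, fun x hx y hy => hlt x (hs.mem_iff.1 hx) y
        (hl.mem_iff.1 hy)⟩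
      · simpa using s.pairwise_mergeSort' (· ≤ ·)
      · simpa using l.pairwise_mergeSort' (· ≤ ·)
    · exact List.pairwise_le_range'
  obtain ⟨h1, h2⟩ := List.append_inj key (by simp)
  exact ⟨h1 ▸ hs.symm, h2 ▸ hl.symm⟩

theorem exists_treeWord_eq (b : Bool) (n k : ℕ) (w : List ℕ) (hw : w.Perm (List.range' k n))
    (ha : PeakAvoiding b w) : ∃ t, treeWord b k t = w := by
  induction n using Nat.strong_induction_on generalizing k w with
  | _ n ih =>
  cases n with
  | zero => exact ⟨.nil, (by simpa using hw : w = []).symm⟩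
  | succ n =>
    have hm : k + n ∈ w := by simp [hw.mem_iff]
    obtain ⟨l, r, rfl⟩ := List.append_of_mem hm
    rw [List.range'_1_concat] at hw
    replace hw : (l ++ r).Perm (List.range' k n) :=
      (List.perm_middle.symm.trans (hw.trans (List.perm_append_singleton _ _))).cons_inv
    have hlt : ∀ x ∈ l ++ r, x < k + n := fun x hx => (List.mem_range'_1.1 (hw.mem_iff.1 hx)).2
    have hn : l.length + r.length = n := by simpa using hw.length_eq
    rw [peakAvoiding_append_cons (fun x hx => hlt x (by simp [hx]))
      (fun x hx => hlt x (by simp [hx]))] at ha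
    obtain ⟨hal, har, hlr⟩ := ha
    cases b with
    | false =>
      obtain ⟨pl, pr⟩ := perm_range'_of_append hw fun x hx y hy => by simpa using hlr x hx y hy
      obtain ⟨tl, rfl⟩ := ih _ (by omega) _ _ pl hal
      obtain ⟨tr, rfl⟩ := ih _ (by omega) _ _ pr har
      refine ⟨.node () tl tr, ?_⟩
      simp only [length_treeWord] at hn ⊢
      simp [treeWord, hn]
    | true =>
      obtain ⟨pr, pl⟩ := perm_range'_of_append (List.perm_append_comm.trans hw)
        fun x hx y hy => by simpa using hlr y hy x hx
      obtain ⟨tr, rfl⟩ := ih _ (by omega) _ _ pr har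
      obtain ⟨tl, rfl⟩ := ih _ (by omega) _ _ pl hal
      refine ⟨.node () tl tr, ?_⟩
      simp only [length_treeWord] at hn ⊢
      simp [treeWord, hn]

/-- The first ascent of a word: the length of its initial decreasing run. -/
def firstAscent : List ℕ → ℕ
  | [] => 0
  | [_] => 1
  | a :: b :: l => if a < b then 1 else firstAscent (b :: l) + 1

theorem firstAscent_cons_of_lt {m : ℕ} {l : List ℕ} (h : ∀ x ∈ l, x < m) :
    firstAscent (m :: l) = firstAscent l + 1 := by
  cases l with
  | nil => rfl
  | cons a l => rw [firstAscent, if_neg (h a (by simp)).not_gt]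

theorem firstAscent_append_cons {m : ℕ} {l r : List ℕ} (hl : l ≠ []) (h : ∀ x ∈ l, x < m) :
    firstAscent (l ++ m :: r) = firstAscent l := by
  induction l with
  | nil => exact absurd rfl hl
  | cons a l ih =>
    cases l with
    | nil => simp [firstAscent, h a (by simp)]
    | cons c l =>
      have := ih (by simp) fun x hx => h x (by simp [hx])
      simp only [List.cons_append, firstAscent] at this ⊢
      rw [this]

theorem firstAscent_spec (l : List ℕ) (hl : l ≠ []) :
    1 ≤ firstAscent l ∧ firstAscent l ≤ l.length ∧
      (firstAscent l = l.length ∨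
        ∃ h : firstAscent l < l.length, l[firstAscent l - 1] < l[firstAscent l]) ∧
      ∀ j, 1 ≤ j → j < firstAscent l → ∀ h : j < l.length, ¬ l[j - 1] < l[j] := by
  induction l with
  | nil => exact absurd rfl hl
  | cons a l ih =>
    cases l with
    | nil => simp [firstAscent]
    | cons c l =>
      have hfa : firstAscent (a :: c :: l) =
          if a < c then 1 else firstAscent (c :: l) + 1 := rfl
      simp only [hfa]
      split_ifs with hac
      · refine ⟨le_rfl, by simp, .inr ⟨by simp, by simpa using hac⟩, fun j h1 h2 => by omega⟩
      · obtain ⟨h1, h2, h3, h4⟩ := ih (by simp)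
        refine ⟨by omega, by simpa using h2, ?_, ?_⟩
        · rcases h3 with h3 | ⟨h, h3⟩
          · left; simpa using h3
          · right
            refine ⟨by simpa using h, ?_⟩
            obtain ⟨i, hi⟩ := Nat.exists_eq_add_of_le' h1
            simp only [hi] at h3 ⊢
            simpa using h3
        · intro j hj1 hj2 hj
          obtain ⟨i, rfl⟩ := Nat.exists_eq_add_of_le' hj1
          rcases Nat.eq_zero_or_pos i with rfl | hi
          · simpa using hac
          · have := h4 i hi (by omega) (by simpa using hj)
            obtain ⟨i, rfl⟩ := Nat.exists_eq_add_of_le' hi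
            simpa using this

/-- The one-line notation of a permutation of `Fin n`. -/
def oneLine {n : ℕ} (π : Equiv.Perm (Fin n)) : List ℕ :=
  List.ofFn fun i => (π i : ℕ)

theorem oneLine_injective (n : ℕ) : Function.Injective (oneLine (n := n)) := by
  intro π ρ h
  ext i
  exact congrFun (List.ofFn_injective h) i

theorem oneLine_perm {n : ℕ} (π : Equiv.Perm (Fin n)) :
    (oneLine π).Perm (List.range' 0 n) := by
  refine (List.perm_ext_iff_of_nodup ?_ List.nodup_range').2 fun x => ?_
  · exact List.nodup_ofFn.2 (Fin.val_injective.comp π.injective)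
  · simp only [oneLine, List.mem_ofFn, List.mem_range'_1]
    constructor
    · rintro ⟨i, rfl⟩
      simp
    · intro h
      exact ⟨π.symm ⟨x, by omega⟩, by simp⟩

theorem exists_oneLine_eq {n : ℕ} {w : List ℕ} (hw : w.Perm (List.range' 0 n)) :
    ∃ π : Equiv.Perm (Fin n), oneLine π = w := by
  obtain rfl : w.length = n := by simpa using hw.length_eq
  have hlt : ∀ i : Fin w.length, w.get i < w.length := fun i => by
    simpa using hw.mem_iff.1 (w.get_mem i)
  have hinj : Function.Injective fun i : Fin w.length => (⟨w.get i, hlt i⟩ : Fin w.length) :=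
    fun i j h => List.nodup_iff_injective_get.1 (hw.nodup_iff.2 List.nodup_range')
      (by simpa using h)
  refine ⟨Equiv.ofBijective _ (Finite.injective_iff_bijective.1 hinj), ?_⟩
  simp only [oneLine, Equiv.ofBijective_apply]
  exact List.ofFn_get w

theorem isDesarrangement_iff {n : ℕ} (π : Equiv.Perm (Fin n)) :
    IsDesarrangement n π ↔ Even (firstAscent (oneLine π)) := by
  rcases Nat.eq_zero_or_pos n with rfl | hn
  · simp [IsDesarrangement, oneLine, firstAscent]
  have hlen : (oneLine π).length = n := by simp [oneLine]
  obtain ⟨h1, h2, h3, h4⟩ := firstAscent_spec (oneLine π)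
    (by rw [← List.length_pos_iff_ne_nil, hlen]; exact hn)
  simp only [hlen] at h2 h3
  have hasc : IsAscent n π (firstAscent (oneLine π)) := by
    refine ⟨h1, h2, h3.imp_right ?_⟩
    rintro ⟨h, h'⟩
    exact ⟨h, by simpa [oneLine] using h'⟩
  have hmin : ∀ j, IsAscent n π j → firstAscent (oneLine π) ≤ j := by
    rintro j ⟨hj1, hj2, hj3⟩
    by_contra! hlt
    obtain rfl | ⟨h, h'⟩ := hj3
    · omega
    · exact h4 j hj1 hlt (by omega) (by simpa [oneLine] using h')
  constructor
  · rintro (h | ⟨i, hi, he, hi'⟩)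
    · omega
    · rwa [le_antisymm (hmin i hi) (hi' _ hasc)]
  · exact fun he => .inr ⟨_, hasc, he, hmin⟩

theorem not_containsPattern_iff {n : ℕ} (b : Bool) (π : Equiv.Perm (Fin n)) :
    ¬ ContainsPattern (if b then ![0, 2, 1] else ![1, 2, 0] : Fin 3 → Fin 3) π ↔
      PeakAvoiding b (oneLine π) := by
  rw [PeakAvoiding, List.triplewise_iff_getElem, not_iff_comm]
  push Not
  constructor
  · rintro ⟨i, j, k, hij, hjk, hk, h⟩
    simp only [oneLine, List.length_ofFn, List.getElem_ofFn, Fin.val_fin_lt] at hk h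
    refine ⟨OrderEmbedding.ofStrictMono
      ![⟨i, by omega⟩, ⟨j, by omega⟩, ⟨k, hk⟩] ?_, ?_⟩
    · intro x y hxy
      fin_cases x <;> fin_cases y <;> simp at hxy ⊢ <;> omega
    · intro x y
      change π (![⟨i, _⟩, ⟨j, _⟩, ⟨k, hk⟩] x) < π (![⟨i, _⟩, ⟨j, _⟩, ⟨k, hk⟩] y) ↔ _
      cases b <;> fin_cases x <;> fin_cases y <;> simp at h ⊢ <;> omega
  · rintro ⟨f, hf⟩
    refine ⟨f 0, f 1, f 2, by simp, by simp, by simp [oneLine], ?_⟩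
    have h01 := hf 0 1
    have h21 := hf 2 1
    have h02 := hf 0 2
    have h20 := hf 2 0
    cases b <;> simp [oneLine] at h01 h21 h02 h20 ⊢ <;> simp [*]

open Finset BinaryTree

theorem even_firstAscent_treeWord_node (b : Bool) (k : ℕ) (l r : BinaryTree Unit) :
    Even (firstAscent (treeWord b k (.node () l r))) ↔
      if l = .nil then ¬ Even (firstAscent (treeWord b k r))
      else Even (firstAscent (treeWord b (k + if b then r.numNodes else 0) l)) := by
  by_cases hl : l = .nil
  · subst hl
    rw [if_pos rfl, treeWord, treeWord, List.nil_append, firstAscent_cons_of_lt, Nat.even_add_one]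
    · cases b <;> simp
    · intro x hx
      rw [mem_treeWord] at hx
      cases b <;> simp at hx ⊢ <;> omega
  · rw [if_neg hl, treeWord, firstAscent_append_cons]
    · cases l with
      | nil => exact absurd rfl hl
      | node => simp [treeWord]
    · intro x hx
      rw [mem_treeWord] at hx
      cases b <;> simp at hx <;> omega

/-- Whether the word of a tree has an even first ascent. -/
def EvenTree : BinaryTree Unit → Prop
  | .nil => True
  | .node _ .nil r => ¬ EvenTree r
  | .node _ (.node _ l l') _ => EvenTree (.node () l l')

theorem even_firstAscent_treeWord (b : Bool) (t : BinaryTree Unit) (k : ℕ) :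
    Even (firstAscent (treeWord b k t)) ↔ EvenTree t := by
  induction t generalizing k with
  | nil => simp [treeWord, firstAscent, EvenTree]
  | node _ l r hl hr =>
    rw [even_firstAscent_treeWord_node, hr, hl]
    cases l <;> simp [EvenTree]

/-- The number of trees with `n` nodes whose word has an even first ascent. -/
noncomputable def evenTreeCount (n : ℕ) : ℕ :=
  #{t ∈ treesOfNumNodesEq n | EvenTree t}

theorem dcount_eq_evenTreeCount (b : Bool) (n : ℕ) :
    dcount n {if b then ![0, 2, 1] else ![1, 2, 0]} = evenTreeCount n := by
  rw [dcount, evenTreeCount, ← card_image_of_injective _ (oneLine_injective n),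
    ← card_image_of_injective (filter _ (treesOfNumNodesEq n)) (treeWord_injective b 0)]
  congr 1
  ext w
  simp only [mem_image, mem_filter, mem_univ, true_and, mem_singleton, forall_eq,
    mem_treesOfNumNodesEq, not_containsPattern_iff, isDesarrangement_iff]
  constructor
  · rintro ⟨π, ⟨hd, ha⟩, rfl⟩
    obtain ⟨t, ht⟩ := exists_treeWord_eq b n 0 _ (oneLine_perm π) ha
    refine ⟨t, ⟨?_, ?_⟩, ht⟩
    · rw [← length_treeWord b t 0, ht, oneLine, List.length_ofFn]
    · rwa [← even_firstAscent_treeWord b t 0, ht]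
  · rintro ⟨t, ⟨rfl, he⟩, rfl⟩
    obtain ⟨π, hπ⟩ := exists_oneLine_eq (treeWord_perm b t 0)
    refine ⟨π, ⟨?_, ?_⟩, hπ⟩
    · rwa [hπ, even_firstAscent_treeWord]
    · rw [hπ]
      exact peakAvoiding_treeWord b t 0

theorem evenTreeCount_zero : evenTreeCount 0 = 1 := by
  simp [evenTreeCount, filter_singleton, EvenTree]

theorem evenTreeCount_succ (n : ℕ) :
    evenTreeCount (n + 1) + evenTreeCount n =
      ∑ ij ∈ antidiagonal n, evenTreeCount ij.1 * catalan ij.2 := by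
  have hsum : evenTreeCount (n + 1) = ∑ ij ∈ antidiagonal n,
      #{x ∈ treesOfNumNodesEq ij.1 ×ˢ treesOfNumNodesEq ij.2 | EvenTree (.node () x.1 x.2)} := by
    rw [evenTreeCount, treesOfNumNodesEq_succ, filter_biUnion, card_biUnion]
    · refine sum_congr rfl fun ij _ => ?_
      rw [filter_map, card_map]
      rfl
    · intro p _ q _ hpq
      rw [Function.onFun, disjoint_left]
      rintro t hp hq
      simp only [mem_filter, mem_map, mem_product, mem_treesOfNumNodesEq] at hp hq
      obtain ⟨⟨x, ⟨h1, h2⟩, rfl⟩, -⟩ := hp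
      obtain ⟨⟨y, ⟨h3, h4⟩, hy⟩, -⟩ := hq
      obtain rfl : y = x := by simpa using hy
      exact hpq (Prod.ext (h1.symm.trans h3) (h2.symm.trans h4))
  rw [hsum]
  have hnode : ∀ i j, i ≠ 0 → #{x ∈ treesOfNumNodesEq i ×ˢ treesOfNumNodesEq j |
      EvenTree (.node () x.1 x.2)} = evenTreeCount i * catalan j := by
    intro i j hi
    rw [evenTreeCount, ← treesOfNumNodesEq_card_eq_catalan, ← card_product]
    congr 1
    ext ⟨l, r⟩
    simp only [mem_filter, mem_product, mem_treesOfNumNodesEq]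
    cases l with
    | nil => simp [hi.symm]
    | node => simp [EvenTree]; tauto
  have hnil : #{x ∈ treesOfNumNodesEq 0 ×ˢ treesOfNumNodesEq n |
      EvenTree (.node () x.1 x.2)} + evenTreeCount n = evenTreeCount 0 * catalan n := by
    rw [evenTreeCount_zero, one_mul, evenTreeCount, ← treesOfNumNodesEq_card_eq_catalan,
      ← card_filter_add_card_filter_not (s := treesOfNumNodesEq n) EvenTree, add_comm]
    congr 1
    rw [treesOfNumNodesEq_zero, singleton_product, filter_map, card_map]
    congr 1
    ext t
    simp [EvenTree]
  have h0 : (0, n) ∈ antidiagonal n := by simp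
  rw [← add_sum_erase _ _ h0, ← add_sum_erase _ _ h0, add_right_comm, hnil]
  congr 1
  refine sum_congr rfl fun ij hij => hnode _ _ fun h => ?_
  obtain ⟨i, j⟩ := ij
  simp at hij h
  omega

theorem catalan_eq_evenTreeCount (n : ℕ) :
    catalan (n + 1) = 2 * evenTreeCount (n + 1) + evenTreeCount n := by
  let C : PowerSeries ℤ := PowerSeries.mk fun n => (catalan n : ℤ)
  let D : PowerSeries ℤ := PowerSeries.mk fun n => (evenTreeCount n : ℤ)
  have hC : C = 1 + PowerSeries.X * (C * C) := by
    ext n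
    cases n with
    | zero => simp [C]
    | succ n =>
      rw [map_add, PowerSeries.coeff_succ_X_mul, PowerSeries.coeff_mul]
      simp [C, PowerSeries.coeff_one, catalan_succ']
  have hD : D + PowerSeries.X * D = 1 + PowerSeries.X * (D * C) := by
    ext n
    cases n with
    | zero => simp [D, evenTreeCount_zero]
    | succ n =>
      rw [map_add, map_add, PowerSeries.coeff_succ_X_mul, PowerSeries.coeff_succ_X_mul,
        PowerSeries.coeff_mul]
      simp only [C, D, PowerSeries.coeff_mk, PowerSeries.coeff_one]
      exact_mod_cast (by simpa using evenTreeCount_succ n)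
  have hne : 1 + PowerSeries.X - PowerSeries.X * C ≠ 0 := fun h => by
    simpa using congrArg PowerSeries.constantCoeff h
  have key : 2 * D + PowerSeries.X * D = C + 1 := by
    refine mul_left_cancel₀ hne ?_
    linear_combination (2 + PowerSeries.X) * hD - hC
  have := congrArg (PowerSeries.coeff (n + 1)) key
  rw [map_add, map_add, PowerSeries.coeff_succ_X_mul, two_mul, map_add] at this
  simp only [C, D, PowerSeries.coeff_mk, PowerSeries.coeff_one] at this
  simp at this
  omega

theorem evenTreeCount_eq_fine {F : ℕ → ℕ} (hF1 : F 1 = 1)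
    (hF : ∀ m : ℕ, 1 ≤ m → catalan m = 2 * F (m + 1) + F m) (n : ℕ) :
    evenTreeCount n = F (n + 1) := by
  induction n with
  | zero => rw [evenTreeCount_zero, hF1]
  | succ n ih =>
    have h1 := hF (n + 1) (by omega)
    have h2 := catalan_eq_evenTreeCount n
    omega

/-- For every integer `n ≥ 2` and each `σ ∈ {132, 231}`, the number of desarrangements of
length `n` avoiding `σ` equals the Fine number `F_(n+1)`, where the Fine numbers are
determined by `F₀ = 0`, `F₁ = 1`, and `C_n = 2·F_(n+1) + F_n` for all `n ≥ 1`. -/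
theorem desarrangements_avoiding_132_or_231 (F : ℕ → ℕ)
    (hF0 : F 0 = 0) (hF1 : F 1 = 1)
    (hF : ∀ m : ℕ, 1 ≤ m → catalan m = 2 * F (m + 1) + F m)
    (n : ℕ) (hn : 2 ≤ n) (σ : Fin 3 → Fin 3)
    (hσ : σ = ![0,2,1] ∨ σ = ![1,2,0]) :
    dcount n {σ} = F (n + 1) := by
  rw [← evenTreeCount_eq_fine hF1 hF]
  rcases hσ with rfl | rfl
  · exact dcount_eq_evenTreeCount true n
  · exact dcount_eq_evenTreeCount false n
end

section
/- For every integer n ≥ 1, the number of desarrangements of length n avoiding both patterns 132 and 321 equals n − 1, i.e. d_n({132, 321}) = n − 1; moreover d_n({132, 231, 321}) = n − 1 as well. -/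
open scoped Classical

/-- A permutation of `Fin (m + 1)` which is strictly increasing away from `0` is determined by its
value at `0`. -/
theorem eq_cycleRange_symm {m : ℕ} (π : Equiv.Perm (Fin (m + 1)))
    (h : StrictMono fun j : Fin m => π j.succ) : π = (π 0).cycleRange.symm := by
  have hr : Set.range (fun j : Fin m => π j.succ) = Set.range (π 0).succAbove := by
    rw [Fin.range_succAbove]
    ext x
    simp only [Set.mem_range, Set.mem_compl_iff, Set.mem_singleton_iff]
    constructor
    · rintro ⟨j, rfl⟩ hj
      exact Fin.succ_ne_zero j (π.injective hj)
    · intro hx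
      have h0 : π.symm x ≠ 0 := fun h0 => hx (by rw [← h0, Equiv.apply_symm_apply])
      obtain ⟨j, hj⟩ := Fin.exists_succ_eq.2 h0
      exact ⟨j, by rw [hj, Equiv.apply_symm_apply]⟩
  have he := (h.range_inj (Fin.strictMono_succAbove (π 0))).1 hr
  ext1 j
  refine Fin.cases ?_ (fun i => ?_) j
  · rw [Fin.cycleRange_symm_zero]
  · rw [Fin.cycleRange_symm_succ]
    exact congrFun he i

/-- Three increasing positions whose letters are ordered as those of `σ` give an occurrence
of `σ`. -/
theorem containsPattern_of_lt {n : ℕ} {σ : Fin 3 → Fin 3} {π : Equiv.Perm (Fin n)}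
    {x y z : Fin n} (hxy : x < y) (hyz : y < z)
    (h : ∀ a b : Fin 3, π (![x, y, z] a) < π (![x, y, z] b) ↔ σ a < σ b) :
    ContainsPattern σ π := by
  refine ⟨OrderEmbedding.ofStrictMono ![x, y, z] ?_, h⟩
  intro a b hab
  fin_cases a <;> fin_cases b <;> simp_all [hxy.trans hyz]

theorem strictMono_of_avoids {m : ℕ} (π : Equiv.Perm (Fin (m + 1)))
    (hd : IsDesarrangement (m + 1) π) (h132 : ¬ ContainsPattern ![0,2,1] π)
    (h321 : ¬ ContainsPattern ![2,1,0] π) :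
    π 0 ≠ 0 ∧ StrictMono fun j : Fin m => π j.succ := by
  have h1 : ¬ IsAscent (m + 1) π 1 := by
    intro h
    obtain hd | ⟨i, hi, he, hmin⟩ := hd
    · omega
    · have := hmin 1 h
      have := hi.1
      obtain rfl : i = 1 := by omega
      exact absurd he (by decide)
  obtain _ | m := m
  · exact absurd ⟨le_rfl, le_rfl, Or.inl rfl⟩ h1
  have h10 : π 1 < π 0 := by
    refine lt_of_le_of_ne (not_lt.1 fun h => h1 ⟨le_rfl, by omega, Or.inr ⟨by omega, h⟩⟩) ?_
    intro h
    exact absurd (π.injective h) (by simp)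
  have hmin : ∀ j, 1 < j → π 1 < π j := by
    intro j hj
    refine lt_of_le_of_ne (not_lt.1 fun h => h321 ?_) (fun h => hj.ne (π.injective h))
    refine containsPattern_of_lt (x := 0) (y := 1) (z := j) (by simp) hj ?_
    have := h.trans h10
    intro a b
    fin_cases a <;> fin_cases b <;> simp [h, h10, this, h.le, h10.le, this.le]
  refine ⟨fun h => by simp [h] at h10, ?_⟩
  intro a b hab
  have hab' : a.succ < b.succ := Fin.succ_lt_succ_iff.2 hab
  rcases Fin.eq_zero_or_eq_succ a with rfl | ⟨c, rfl⟩
  · exact hmin _ hab'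
  · have hc : 1 < c.succ.succ := by
      simp [Fin.lt_def]
    refine lt_of_le_of_ne (not_lt.1 fun h => h132 ?_) (fun h => hab'.ne (π.injective h))
    refine containsPattern_of_lt (x := 1) hc hab' ?_
    have h2 := hmin _ hc
    have h3 := hmin _ (hc.trans hab')
    have h4 : π b.succ < π c.succ.succ := h
    intro a b
    fin_cases a <;> fin_cases b <;> simp [h2, h3, h4, h2.le, h3.le, h4.le]

theorem strictMono_cycleRange_symm_succ {m : ℕ} (k : Fin (m + 1)) :
    StrictMono fun j : Fin m => k.cycleRange.symm j.succ := by
  simpa only [Fin.cycleRange_symm_succ] using Fin.strictMono_succAbove k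

theorem isDesarrangement_cycleRange_symm {m : ℕ} {k : Fin (m + 1)} (hk : k ≠ 0) :
    IsDesarrangement (m + 1) k.cycleRange.symm := by
  obtain _ | m := m
  · exact absurd (Subsingleton.elim (α := Fin 1) k 0) hk
  have hs := strictMono_cycleRange_symm_succ k
  refine Or.inr ⟨2, ⟨by omega, by omega, ?_⟩, even_two, ?_⟩
  · by_cases hm : m = 0
    · left; omega
    · right
      refine ⟨by omega, ?_⟩
      exact hs (a := ⟨0, by omega⟩) (b := ⟨1, by omega⟩) (by simp [Fin.lt_def])
  · rintro j ⟨hj, -, h⟩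
    by_contra hlt
    obtain rfl : j = 1 := by omega
    obtain h | ⟨_, h⟩ := h
    · omega
    · have h' : k.cycleRange.symm 0 < k.cycleRange.symm (Fin.succ 0) := h
      rw [Fin.cycleRange_symm_zero, Fin.cycleRange_symm_succ, Fin.succAbove_ne_zero_zero hk] at h'
      exact absurd h' (Fin.not_lt_zero k)

/-- Every descent of `k.cycleRange.symm` starts at its first letter, so patterns with a descent
at the last two positions are avoided. -/
theorem not_containsPattern_cycleRange_symm {m : ℕ} (k : Fin (m + 1)) {σ : Fin 3 → Fin 3}
    (hσ : σ 2 < σ 1) : ¬ ContainsPattern σ k.cycleRange.symm := by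
  rintro ⟨f, hf⟩
  have h01 : f 0 < f 1 := f.strictMono (by decide)
  have h12 : f 1 < f 2 := f.strictMono (by decide)
  obtain ⟨a, ha⟩ := Fin.exists_succ_eq.2 ((Fin.zero_le _).trans_lt h01).ne'
  obtain ⟨b, hb⟩ := Fin.exists_succ_eq.2 ((Fin.zero_le _).trans_lt (h01.trans h12)).ne'
  have h := (hf 2 1).2 hσ
  rw [← ha, ← hb] at h h12
  exact lt_asymm h (strictMono_cycleRange_symm_succ k (Fin.succ_lt_succ_iff.1 h12))

theorem dcount_succ {m : ℕ} {P : Finset (Fin 3 → Fin 3)} (h132 : ![0,2,1] ∈ P)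
    (h321 : ![2,1,0] ∈ P) (hP : ∀ σ ∈ P, σ 2 < σ 1) : dcount (m + 1) P = m := by
  have himage : (Finset.univ.filter fun π : Equiv.Perm (Fin (m + 1)) =>
      IsDesarrangement (m + 1) π ∧ ∀ σ ∈ P, ¬ ContainsPattern σ π) =
      (Finset.univ.erase (0 : Fin (m + 1))).image fun k => k.cycleRange.symm := by
    ext π
    simp only [Finset.mem_filter, Finset.mem_univ, true_and, Finset.mem_image, Finset.mem_erase,
      and_true]
    constructor
    · rintro ⟨hd, hav⟩
      obtain ⟨h0, hs⟩ := strictMono_of_avoids π hd (hav _ h132) (hav _ h321)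
      exact ⟨π 0, h0, (eq_cycleRange_symm π hs).symm⟩
    · rintro ⟨k, hk, rfl⟩
      exact ⟨isDesarrangement_cycleRange_symm hk,
        fun σ hσ => not_containsPattern_cycleRange_symm k (hP σ hσ)⟩
  have hinj : Function.Injective fun k : Fin (m + 1) => k.cycleRange.symm := by
    intro k l h
    simpa using DFunLike.congr_fun h 0
  rw [dcount, himage, Finset.card_image_of_injective _ hinj]
  simp

/-- For every integer `n ≥ 1`, `d_n({132, 321}) = n − 1` and `d_n({132, 231, 321}) = n − 1`. -/
theorem desarrangements_avoiding_132_321 (n : ℕ) (hn : 1 ≤ n) :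
    dcount n {![0,2,1], ![2,1,0]} = n - 1 ∧
    dcount n {![0,2,1], ![1,2,0], ![2,1,0]} = n - 1 := by
  obtain ⟨m, rfl⟩ := Nat.exists_eq_add_of_le' hn
  exact ⟨dcount_succ (by simp) (by simp) (by simp),
    dcount_succ (by simp) (by simp) (by simp)⟩
end

section
/- For every integer n ≥ 2, the number of desarrangements of length n avoiding both patterns 132 and 231 equals 2^{n−2}, i.e. d_n({132, 231}) = 2^{n−2}. -/
open scoped Classical

/-- `π` has no (not necessarily consecutive) peak `i < j < k`. -/
def Peakless {n : ℕ} (π : Equiv.Perm (Fin n)) : Prop :=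
  ∀ i j k : Fin n, i < j → j < k → π i < π j → π k < π j → False

theorem containsPattern_of_triple {n : ℕ} {σ : Fin 3 → Fin 3} {π : Equiv.Perm (Fin n)}
    {i j k : Fin n} (hij : i < j) (hjk : j < k)
    (h : ∀ a b : Fin 3, π (![i, j, k] a) < π (![i, j, k] b) ↔ σ a < σ b) :
    ContainsPattern σ π := by
  have hmono : StrictMono ![i, j, k] := by
    intro a b hab
    fin_cases a <;> fin_cases b <;> simp_all
    exact hij.trans hjk
  exact ⟨OrderEmbedding.ofStrictMono _ hmono, h⟩

theorem avoids_iff_peakless {n : ℕ} (π : Equiv.Perm (Fin n)) :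
    (∀ σ ∈ ({![0,2,1], ![1,2,0]} : Finset (Fin 3 → Fin 3)), ¬ ContainsPattern σ π) ↔
      Peakless π := by
  constructor
  · intro h i j k hij hjk h1 h2
    have hne : π i ≠ π k := fun e => (hij.trans hjk).ne (π.injective e)
    rcases lt_or_gt_of_ne hne with h3 | h3
    · refine h ![0,2,1] (by simp) (containsPattern_of_triple hij hjk ?_)
      intro a b
      fin_cases a <;> fin_cases b <;> simp [h1, h2, h3, h1.le, h2.le, h3.le]
    · refine h ![1,2,0] (by simp) (containsPattern_of_triple hij hjk ?_)
      intro a b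
      fin_cases a <;> fin_cases b <;> simp [h1, h2, h3, h1.le, h2.le, h3.le]
  · intro h σ hσ hc
    obtain ⟨f, hf⟩ := hc
    have h01 : f 0 < f 1 := f.strictMono (by decide)
    have h12 : f 1 < f 2 := f.strictMono (by decide)
    simp only [Finset.mem_insert, Finset.mem_singleton] at hσ
    rcases hσ with rfl | rfl
    · exact h _ _ _ h01 h12 ((hf 0 1).2 (by decide)) ((hf 2 1).2 (by decide))
    · exact h _ _ _ h01 h12 ((hf 0 1).2 (by decide)) ((hf 2 1).2 (by decide))

/-- The set of values that appear to the left of the smallest value. -/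
noncomputable def leftValues {m : ℕ} (π : Equiv.Perm (Fin (m + 1))) : Finset (Fin (m + 1)) :=
  Finset.univ.filter fun v => π.symm v < π.symm 0

theorem mem_leftValues {m : ℕ} {π : Equiv.Perm (Fin (m + 1))} {v : Fin (m + 1)} :
    v ∈ leftValues π ↔ π.symm v < π.symm 0 := by
  simp [leftValues]

theorem card_leftValues {m : ℕ} (π : Equiv.Perm (Fin (m + 1))) :
    (leftValues π).card = (π.symm 0 : ℕ) := by
  have h : leftValues π = (Finset.Iio (π.symm 0)).map π.toEmbedding := by
    ext v
    simp [mem_leftValues]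
  rw [h, Finset.card_map, Fin.card_Iio]

/-- Sorting the values by this key lists those in `S` decreasingly, then the others
increasingly. -/
noncomputable def valleyKey {n : ℕ} (S : Finset (Fin n)) (v : Fin n) : ℤ :=
  if v ∈ S then -((v : ℕ) : ℤ) else ((v : ℕ) : ℤ)

theorem valleyKey_injective {m : ℕ} (S : Finset (Fin (m + 1))) :
    Function.Injective (valleyKey S) := by
  intro u v h
  unfold valleyKey at h
  ext
  split_ifs at h <;> omega

theorem Peakless.strictMono_valleyKey {m : ℕ} {π : Equiv.Perm (Fin (m + 1))}
    (h : Peakless π) : StrictMono (valleyKey (leftValues π) ∘ π) := by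
  intro i j hij
  have hne : π i ≠ π j := fun e => hij.ne (π.injective e)
  simp only [Function.comp, valleyKey, mem_leftValues, Equiv.symm_apply_apply]
  rcases lt_or_gt_of_ne hne with hlt | hlt
  · have hj : ¬ j < π.symm 0 := fun hj =>
      h i j (π.symm 0) hij hj hlt (by simpa using (Fin.zero_le _).trans_lt hlt)
    rw [if_neg hj]
    have : (π i : ℕ) < π j := hlt
    split_ifs <;> omega
  · have hi : i < π.symm 0 := by
      by_contra hi
      have hpos : 0 < π i := (Fin.zero_le _).trans_lt hlt
      have hi' : π.symm 0 < i := lt_of_le_of_ne (not_lt.1 hi) (by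
        rintro rfl
        simp at hpos)
      exact h (π.symm 0) i j hi' hij (by simpa using hpos) hlt
    rw [if_pos hi]
    have : (π j : ℕ) < π i := hlt
    split_ifs <;> omega

theorem leftValues_eq_of_strictMono {m : ℕ} {S : Finset (Fin (m + 1))} (hS : 0 ∉ S)
    {π : Equiv.Perm (Fin (m + 1))} (h : StrictMono (valleyKey S ∘ π)) :
    leftValues π = S := by
  ext v
  rw [mem_leftValues, ← h.lt_iff_lt]
  simp only [Function.comp, Equiv.apply_symm_apply, valleyKey, if_neg hS]
  by_cases hv : v ∈ S
  · have : v ≠ 0 := fun e => hS (e ▸ hv)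
    have : 0 < (v : ℕ) := Fin.pos_iff_ne_zero.2 this
    simp [hv, this]
  · simp [hv]

theorem peakless_of_strictMono {n : ℕ} {S : Finset (Fin n)} {π : Equiv.Perm (Fin n)}
    (h : StrictMono (valleyKey S ∘ π)) : Peakless π := by
  intro i j k hij hjk h1 h2
  have a := h hij
  have b := h hjk
  simp only [Function.comp, valleyKey] at a b
  have : (π i : ℕ) < π j := h1
  have : (π k : ℕ) < π j := h2
  split_ifs at a b <;> omega

theorem Peakless.isDesarrangement_iff {m : ℕ} {π : Equiv.Perm (Fin (m + 1))}
    (h : Peakless π) : IsDesarrangement (m + 1) π ↔ Odd (leftValues π).card := by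
  rw [card_leftValues]
  set p := π.symm 0 with hp
  have hp0 : π p = 0 := by simp [hp]
  have hasc : IsAscent (m + 1) π (p + 1) := by
    refine ⟨by omega, p.isLt, ?_⟩
    by_cases hlast : (p : ℕ) + 1 = m + 1
    · exact Or.inl hlast
    · refine Or.inr ⟨by omega, ?_⟩
      simp only [Nat.add_sub_cancel, Fin.eta, hp0]
      refine Fin.pos_iff_ne_zero.2 fun e => ?_
      have := congrArg Fin.val (π.injective (e.trans hp0.symm))
      simp at this
  have hmin : ∀ j, IsAscent (m + 1) π j → (p : ℕ) + 1 ≤ j := by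
    rintro j ⟨hj1, hjn, hj⟩
    by_contra hlt
    rcases hj with hj | ⟨hjn', hj⟩
    · omega
    · have hpos : 0 < π ⟨j, hjn'⟩ := (Fin.zero_le _).trans_lt hj
      have hne : j ≠ p := by
        rintro rfl
        simp [hp0] at hpos
      exact h _ _ p (Fin.mk_lt_mk.2 (by omega)) (Fin.lt_def.2 (by simp; omega)) hj
        (by rwa [hp0])
  constructor
  · rintro (h0 | ⟨i, hi, hev, hle⟩)
    · omega
    · have : i = p + 1 := le_antisymm (hle _ hasc) (hmin _ hi)
      subst this
      simpa [Nat.even_add_one] using hev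
  · intro hodd
    exact Or.inr ⟨p + 1, hasc, hodd.add_one, hmin⟩

theorem card_powerset_filter_odd {α : Type*} {s : Finset α} (hs : s.Nonempty) :
    (s.powerset.filter fun t => Odd t.card).card = 2 ^ (s.card - 1) := by
  have h0 := Finset.sum_powerset_neg_one_pow_card_of_nonempty hs
  have h1 : ∑ t ∈ s.powerset, (1 - (-1 : ℤ) ^ t.card) =
      ∑ t ∈ s.powerset, if Odd t.card then 2 else 0 := by
    refine Finset.sum_congr rfl fun t _ => ?_
    split_ifs with ht
    · simp [ht.neg_one_pow]
    · simp [(Nat.not_odd_iff_even.1 ht).neg_one_pow]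
  rw [Finset.sum_sub_distrib, h0, ← Finset.sum_filter] at h1
  simp only [Finset.sum_const, Finset.card_powerset, nsmul_eq_mul, mul_one, sub_zero] at h1
  obtain ⟨c, hc⟩ := Nat.exists_eq_add_of_lt hs.card_pos
  rw [zero_add] at hc
  rw [hc, pow_succ] at h1
  rw [hc, Nat.add_sub_cancel]
  norm_cast at h1
  omega

/-- For every integer `n ≥ 2`, `d_n({132, 231}) = 2^(n−2)`. -/
theorem desarrangements_avoiding_132_231 (n : ℕ) (hn : 2 ≤ n) :
    dcount n {![0,2,1], ![1,2,0]} = 2 ^ (n - 2) := by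
  obtain ⟨m, rfl⟩ := Nat.exists_eq_add_of_le' hn
  have hcard : ((Finset.univ : Finset (Fin (m + 2))).erase 0).card = m + 1 := by simp
  have hodd := card_powerset_filter_odd (Finset.card_pos.1 (by rw [hcard]; exact m.succ_pos))
  rw [hcard] at hodd
  rw [Nat.add_sub_cancel, ← Nat.add_sub_cancel (n := m) (m := 1), ← hodd, dcount]
  simp only [avoids_iff_peakless]
  refine Finset.card_bij (fun π _ => leftValues π) ?_ ?_ ?_
  · intro π hπ
    obtain ⟨hd, hpk⟩ := (Finset.mem_filter.1 hπ).2
    refine Finset.mem_filter.2 ⟨?_, hpk.isDesarrangement_iff.1 hd⟩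
    refine Finset.mem_powerset.2 fun v hv => ?_
    refine Finset.mem_erase.2 ⟨?_, Finset.mem_univ _⟩
    rintro rfl
    exact lt_irrefl _ (mem_leftValues.1 hv)
  · intro π hπ ρ hρ hS
    have h1 := (Finset.mem_filter.1 hπ).2.2.strictMono_valleyKey
    have h2 := (Finset.mem_filter.1 hρ).2.2.strictMono_valleyKey
    rw [← hS] at h2
    have h3 := Tuple.unique_monotone h1.monotone h2.monotone
    exact Equiv.ext fun i => valleyKey_injective _ (congrFun h3 i)
  · intro S hS
    obtain ⟨hsub, hSodd⟩ := Finset.mem_filter.1 hS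
    have h0 : (0 : Fin (m + 2)) ∉ S := fun h =>
      Finset.notMem_erase _ _ (Finset.mem_powerset.1 hsub h)
    have hmono : StrictMono (valleyKey S ∘ Tuple.sort (valleyKey S)) :=
      (Tuple.monotone_sort _).strictMono_of_injective
        ((valleyKey_injective S).comp (Equiv.injective _))
    have hL := leftValues_eq_of_strictMono h0 hmono
    have hpk := peakless_of_strictMono hmono
    exact ⟨_, Finset.mem_filter.2 ⟨Finset.mem_univ _,
      hpk.isDesarrangement_iff.2 (hL.symm ▸ hSodd), hpk⟩, hL⟩
end
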